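/- Suppose the full-space MN problem is feasible, and let (α, H) and (α̂, Ĥ) be the unique minimizers of the full-space and subspace MN problems, respectively. Then for every x̂ ∈ ℝᵈ and every v ∈ col(Q)⊥, the associated models satisfy m(x⁰ + Q x̂ + v) = m̂(x̂). -/

import Mathlib

open Matrix

/-- Squared Frobenius norm of a real matrix. -/
noncomputable def frobSq {a b : ℕ} (A : Matrix (Fin a) (Fin b) ℝ) : ℝ :=
  ∑ i, ∑ j, (A i j) ^ 2

/-- Squared Euclidean norm of a real vector. -/
noncomputable def vecNormSq {a : ℕ} (v : Fin a → ℝ) : ℝ :=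
  ∑ i, (v i) ^ 2

/-- `v` lies in the orthogonal complement of the column space of `Q`. -/
def inColPerp {n d : ℕ} (Q : Matrix (Fin n) (Fin d) ℝ) (v : Fin n → ℝ) : Prop :=
  ∀ u : Fin d → ℝ, Q.mulVec u ⬝ᵥ v = 0

/-- Feasibility for the quadratic interpolation constraints: `p = (α, H)` with `H`
symmetric and `(dᵢ)ᵀ α + ½ (dᵢ)ᵀ H dᵢ = rhs i` for all `i`. -/
def QFeas {k m : ℕ} (dd : Fin m → Fin k → ℝ) (rhs : Fin m → ℝ)
    (p : (Fin k → ℝ) × Matrix (Fin k) (Fin k) ℝ) : Prop :=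
  p.2.IsSymm ∧ ∀ i, dd i ⬝ᵥ p.1 + (1 / 2) * (dd i ⬝ᵥ p.2.mulVec (dd i)) = rhs i

/-- Objective of the minimum norm (MN) problem. -/
noncomputable def MNObj {k : ℕ} (p : (Fin k → ℝ) × Matrix (Fin k) (Fin k) ℝ) : ℝ :=
  (1 / 2) * vecNormSq p.1 + (1 / 2) * frobSq p.2

/-- `p` is a minimizer of the MN problem. -/
def MNMin {k m : ℕ} (dd : Fin m → Fin k → ℝ) (rhs : Fin m → ℝ)
    (p : (Fin k → ℝ) × Matrix (Fin k) (Fin k) ℝ) : Prop :=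
  QFeas dd rhs p ∧ ∀ q, QFeas dd rhs q → MNObj p ≤ MNObj q

/-- Objective of the minimum Frobenius norm (MFN) problem. -/
noncomputable def MFNObj {k : ℕ} (p : (Fin k → ℝ) × Matrix (Fin k) (Fin k) ℝ) : ℝ :=
  (1 / 2) * frobSq p.2

/-- `p` is a minimizer of the MFN problem. -/
def MFNMin {k m : ℕ} (dd : Fin m → Fin k → ℝ) (rhs : Fin m → ℝ)
    (p : (Fin k → ℝ) × Matrix (Fin k) (Fin k) ℝ) : Prop :=
  QFeas dd rhs p ∧ ∀ q, QFeas dd rhs q → MFNObj p ≤ MFNObj q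

/-- Objective of the least Frobenius norm updating (LFU) problem. -/
noncomputable def LFUObj {k : ℕ} (Hbar : Matrix (Fin k) (Fin k) ℝ)
    (p : (Fin k → ℝ) × Matrix (Fin k) (Fin k) ℝ) : ℝ :=
  (1 / 2) * frobSq (p.2 - Hbar)

/-- `p` is a minimizer of the LFU problem with reference matrix `Hbar`. -/
def LFUMin {k m : ℕ} (dd : Fin m → Fin k → ℝ) (rhs : Fin m → ℝ)
    (Hbar : Matrix (Fin k) (Fin k) ℝ)
    (p : (Fin k → ℝ) × Matrix (Fin k) (Fin k) ℝ) : Prop :=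
  QFeas dd rhs p ∧ ∀ q, QFeas dd rhs q → LFUObj Hbar p ≤ LFUObj Hbar q

/-- `X` is a Moore–Penrose pseudoinverse of `A`. -/
def IsMPInv {a b : ℕ} (A : Matrix (Fin a) (Fin b) ℝ) (X : Matrix (Fin b) (Fin a) ℝ) : Prop :=
  A * X * A = A ∧ X * A * X = X ∧ (A * X)ᵀ = A * X ∧ (X * A)ᵀ = X * A

/-- The vector `δ_g(y⁰; W)` with `i`-th entry `g(y⁰ + wⁱ) − g(y⁰)`,
where `wⁱ` is the `i`-th column of `W`. -/
noncomputable def deltaVec {k p : ℕ} (g : (Fin k → ℝ) → ℝ) (y0 : Fin k → ℝ)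
    (W : Matrix (Fin k) (Fin p) ℝ) : Fin p → ℝ :=
  fun i => g (y0 + fun j => W j i) - g y0

theorem vecNormSq_eq_dotProduct {a : ℕ} (v : Fin a → ℝ) : vecNormSq v = v ⬝ᵥ v := by
  simp [vecNormSq, dotProduct, pow_two]

theorem vecNormSq_nonneg {a : ℕ} (v : Fin a → ℝ) : 0 ≤ vecNormSq v :=
  Finset.sum_nonneg fun _ _ => sq_nonneg _

theorem frobSq_nonneg {a b : ℕ} (A : Matrix (Fin a) (Fin b) ℝ) : 0 ≤ frobSq A :=
  Finset.sum_nonneg fun _ _ => Finset.sum_nonneg fun _ _ => sq_nonneg _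

theorem frobSq_transpose {a b : ℕ} (A : Matrix (Fin a) (Fin b) ℝ) : frobSq Aᵀ = frobSq A :=
  Finset.sum_comm

theorem frobSq_eq_sum_col {a b : ℕ} (A : Matrix (Fin a) (Fin b) ℝ) :
    frobSq A = ∑ j, vecNormSq fun i => A i j :=
  Finset.sum_comm

section Orthonormal

variable {n d : ℕ} {Q : Matrix (Fin n) (Fin d) ℝ}

theorem mulVec_dotProduct_mulVec_of_orthonormal (hQ : Qᵀ * Q = 1) (u v : Fin d → ℝ) :
    Q *ᵥ u ⬝ᵥ Q *ᵥ v = u ⬝ᵥ v := by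
  rw [dotProduct_mulVec, ← mulVec_transpose, mulVec_mulVec, hQ, one_mulVec]

theorem vecNormSq_mulVec (hQ : Qᵀ * Q = 1) (v : Fin d → ℝ) :
    vecNormSq (Q *ᵥ v) = vecNormSq v := by
  simp only [vecNormSq_eq_dotProduct, mulVec_dotProduct_mulVec_of_orthonormal hQ]

theorem vecNormSq_transpose_mulVec_le (hQ : Qᵀ * Q = 1) (x : Fin n → ℝ) :
    vecNormSq (Qᵀ *ᵥ x) ≤ vecNormSq x := by
  have h := vecNormSq_nonneg (x - Q *ᵥ (Qᵀ *ᵥ x))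
  have hx : x ⬝ᵥ Q *ᵥ (Qᵀ *ᵥ x) = Qᵀ *ᵥ x ⬝ᵥ Qᵀ *ᵥ x := by
    rw [dotProduct_mulVec, ← mulVec_transpose]
  simp only [vecNormSq_eq_dotProduct] at h ⊢
  rw [sub_dotProduct, dotProduct_sub, dotProduct_sub,
    mulVec_dotProduct_mulVec_of_orthonormal hQ, dotProduct_comm (Q *ᵥ _) x, hx] at h
  linarith

theorem frobSq_mul {k : ℕ} (hQ : Qᵀ * Q = 1) (A : Matrix (Fin d) (Fin k) ℝ) :
    frobSq (Q * A) = frobSq A := by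
  simp only [frobSq_eq_sum_col]
  exact Finset.sum_congr rfl fun j _ => vecNormSq_mulVec hQ fun i => A i j

theorem frobSq_transpose_mul_le {k : ℕ} (hQ : Qᵀ * Q = 1) (A : Matrix (Fin n) (Fin k) ℝ) :
    frobSq (Qᵀ * A) ≤ frobSq A := by
  simp only [frobSq_eq_sum_col]
  exact Finset.sum_le_sum fun j _ => vecNormSq_transpose_mulVec_le hQ fun i => A i j

theorem frobSq_conj (hQ : Qᵀ * Q = 1) (A : Matrix (Fin d) (Fin d) ℝ) :
    frobSq (Q * A * Qᵀ) = frobSq A := by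
  rw [← frobSq_transpose, transpose_mul, transpose_transpose, frobSq_mul hQ, frobSq_transpose,
    frobSq_mul hQ]

theorem frobSq_transpose_conj_le (hQ : Qᵀ * Q = 1) (A : Matrix (Fin n) (Fin n) ℝ) :
    frobSq (Qᵀ * A * Q) ≤ frobSq A := by
  rw [← frobSq_transpose, transpose_mul]
  refine (frobSq_transpose_mul_le hQ _).trans ?_
  rw [frobSq_transpose]
  exact frobSq_transpose_mul_le hQ A

theorem MNObj_lift (hQ : Qᵀ * Q = 1) (p : (Fin d → ℝ) × Matrix (Fin d) (Fin d) ℝ) :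
    MNObj (Q *ᵥ p.1, Q * p.2 * Qᵀ) = MNObj p := by
  simp only [MNObj, vecNormSq_mulVec hQ, frobSq_conj hQ]

theorem MNObj_compress_le (hQ : Qᵀ * Q = 1) (p : (Fin n → ℝ) × Matrix (Fin n) (Fin n) ℝ) :
    MNObj (Qᵀ *ᵥ p.1, Qᵀ * p.2 * Q) ≤ MNObj p := by
  have h₁ := vecNormSq_transpose_mulVec_le hQ p.1
  have h₂ := frobSq_transpose_conj_le hQ p.2
  simp only [MNObj]
  linarith

theorem QFeas.lift {m : ℕ} (hQ : Qᵀ * Q = 1) {dh : Fin m → Fin d → ℝ} {rhs : Fin m → ℝ}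
    {p : (Fin d → ℝ) × Matrix (Fin d) (Fin d) ℝ} (hp : QFeas dh rhs p) :
    QFeas (fun i => Q *ᵥ dh i) rhs (Q *ᵥ p.1, Q * p.2 * Qᵀ) := by
  refine ⟨?_, fun i => ?_⟩
  · simp only [IsSymm, transpose_mul, transpose_transpose, hp.1.eq, Matrix.mul_assoc]
  · have h : (Q * p.2 * Qᵀ) *ᵥ (Q *ᵥ dh i) = Q *ᵥ (p.2 *ᵥ dh i) := by
      rw [mulVec_mulVec, Matrix.mul_assoc, hQ, Matrix.mul_one, mulVec_mulVec]
    simp only [h, mulVec_dotProduct_mulVec_of_orthonormal hQ]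
    exact hp.2 i

theorem QFeas.compress {m : ℕ} {dh : Fin m → Fin d → ℝ} {rhs : Fin m → ℝ}
    {p : (Fin n → ℝ) × Matrix (Fin n) (Fin n) ℝ} (hp : QFeas (fun i => Q *ᵥ dh i) rhs p) :
    QFeas dh rhs (Qᵀ *ᵥ p.1, Qᵀ * p.2 * Q) := by
  refine ⟨?_, fun i => ?_⟩
  · simp only [IsSymm, transpose_mul, transpose_transpose, hp.1.eq, Matrix.mul_assoc]
  · have h (w : Fin n → ℝ) : dh i ⬝ᵥ Qᵀ *ᵥ w = Q *ᵥ dh i ⬝ᵥ w := by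
      rw [dotProduct_mulVec, vecMul_transpose]
    rw [← hp.2 i]
    simp only [Matrix.mul_assoc, ← mulVec_mulVec, h]

theorem MNMin.lift {m : ℕ} (hQ : Qᵀ * Q = 1) {dh : Fin m → Fin d → ℝ} {rhs : Fin m → ℝ}
    {p : (Fin d → ℝ) × Matrix (Fin d) (Fin d) ℝ} (hp : MNMin dh rhs p) :
    MNMin (fun i => Q *ᵥ dh i) rhs (Q *ᵥ p.1, Q * p.2 * Qᵀ) :=
  ⟨hp.1.lift hQ, fun q hq =>
    (MNObj_lift hQ p).trans_le ((hp.2 _ hq.compress).trans (MNObj_compress_le hQ q))⟩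

theorem inColPerp.transpose_mulVec_eq_zero {v : Fin n → ℝ} (hv : inColPerp Q v) :
    Qᵀ *ᵥ v = 0 := by
  rw [← dotProduct_self_eq_zero, dotProduct_mulVec, vecMul_transpose]
  exact hv _

end Orthonormal

theorem QFeas.midpoint {k m : ℕ} {dd : Fin m → Fin k → ℝ} {rhs : Fin m → ℝ}
    {p q : (Fin k → ℝ) × Matrix (Fin k) (Fin k) ℝ} (hp : QFeas dd rhs p) (hq : QFeas dd rhs q) :
    QFeas dd rhs ((1 / 2 : ℝ) • (p + q)) := by
  refine ⟨(hp.1.add hq.1).smul _, fun i => ?_⟩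
  have h₁ := hp.2 i
  have h₂ := hq.2 i
  simp only [Prod.smul_fst, Prod.smul_snd, Prod.fst_add, Prod.snd_add, dotProduct_smul,
    smul_mulVec, add_mulVec, dotProduct_add, smul_eq_mul]
  linarith

theorem vecNormSq_midpoint {a : ℕ} (u v : Fin a → ℝ) :
    vecNormSq ((1 / 2 : ℝ) • (u + v)) =
      (1 / 2) * vecNormSq u + (1 / 2) * vecNormSq v - (1 / 4) * vecNormSq (u - v) := by
  simp only [vecNormSq, Finset.mul_sum, ← Finset.sum_add_distrib, ← Finset.sum_sub_distrib,
    Pi.smul_apply, Pi.add_apply, Pi.sub_apply, smul_eq_mul]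
  exact Finset.sum_congr rfl fun _ _ => by ring

theorem frobSq_midpoint {a b : ℕ} (A B : Matrix (Fin a) (Fin b) ℝ) :
    frobSq ((1 / 2 : ℝ) • (A + B)) =
      (1 / 2) * frobSq A + (1 / 2) * frobSq B - (1 / 4) * frobSq (A - B) := by
  simp only [frobSq, Finset.mul_sum, ← Finset.sum_add_distrib, ← Finset.sum_sub_distrib,
    Matrix.smul_apply, Matrix.add_apply, Matrix.sub_apply, smul_eq_mul]
  exact Finset.sum_congr rfl fun _ _ => Finset.sum_congr rfl fun _ _ => by ring

theorem vecNormSq_eq_zero {a : ℕ} {v : Fin a → ℝ} : vecNormSq v = 0 ↔ v = 0 := by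
  rw [vecNormSq_eq_dotProduct, dotProduct_self_eq_zero]

theorem frobSq_eq_zero {a b : ℕ} {A : Matrix (Fin a) (Fin b) ℝ} : frobSq A = 0 ↔ A = 0 := by
  rw [frobSq_eq_sum_col, Finset.sum_eq_zero_iff_of_nonneg fun _ _ => vecNormSq_nonneg _]
  simp only [Finset.mem_univ, true_imp_iff, vecNormSq_eq_zero, funext_iff, ← Matrix.ext_iff]
  exact forall_comm

theorem MNMin.unique {k m : ℕ} {dd : Fin m → Fin k → ℝ} {rhs : Fin m → ℝ}
    {p q : (Fin k → ℝ) × Matrix (Fin k) (Fin k) ℝ} (hp : MNMin dd rhs p) (hq : MNMin dd rhs q) :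
    p = q := by
  have hpr := hp.2 _ (hp.1.midpoint hq.1)
  have hqr := hq.2 _ (hp.1.midpoint hq.1)
  simp only [MNObj, Prod.smul_fst, Prod.smul_snd, Prod.fst_add, Prod.snd_add,
    vecNormSq_midpoint, frobSq_midpoint] at hpr hqr
  have h₁ := vecNormSq_nonneg (p.1 - q.1)
  have h₂ := frobSq_nonneg (p.2 - q.2)
  refine Prod.ext (sub_eq_zero.1 (vecNormSq_eq_zero.1 ?_)) (sub_eq_zero.1 (frobSq_eq_zero.1 ?_))
    <;> linarith

/-- If the full-space MN problem is feasible and `(α, H)`, `(α̂, Ĥ)` are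
the unique minimizers of the full-space and subspace MN problems, then
`m(x⁰ + Q x̂ + v) = m̂(x̂)` for every `x̂ ∈ ℝᵈ` and every `v ∈ col(Q)⊥`. -/
theorem stmt_1 {n d m : ℕ} (hn : 0 < n) (hd : 0 < d) (hm : 0 < m) (hdn : d < n)
    (Q : Matrix (Fin n) (Fin d) ℝ) (hQ : Qᵀ * Q = 1)
    (f : (Fin n → ℝ) → ℝ) (x0 : Fin n → ℝ) (dh : Fin m → Fin d → ℝ)
    (fh : (Fin d → ℝ) → ℝ) (hfh : ∀ xh, fh xh = f (x0 + Q.mulVec xh))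
    (hfeas : ∃ p, QFeas (fun i => Q.mulVec (dh i))
      (fun i => f (x0 + Q.mulVec (dh i)) - f x0) p)
    (α : Fin n → ℝ) (H : Matrix (Fin n) (Fin n) ℝ)
    (hmin : MNMin (fun i => Q.mulVec (dh i))
      (fun i => f (x0 + Q.mulVec (dh i)) - f x0) (α, H))
    (αh : Fin d → ℝ) (Hh : Matrix (Fin d) (Fin d) ℝ)
    (hminh : MNMin dh (fun i => fh (dh i) - fh 0) (αh, Hh)) :
    ∀ (xh : Fin d → ℝ) (v : Fin n → ℝ), inColPerp Q v →
      f x0 + α ⬝ᵥ (x0 + Q.mulVec xh + v - x0)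
        + (1 / 2) * ((x0 + Q.mulVec xh + v - x0) ⬝ᵥ H.mulVec (x0 + Q.mulVec xh + v - x0))
      = fh 0 + αh ⬝ᵥ xh + (1 / 2) * (xh ⬝ᵥ Hh.mulVec xh) := by
  intro xh v hv
  have hfh0 : fh 0 = f x0 := by rw [hfh, mulVec_zero, add_zero]
  simp only [hfh0, hfh] at hminh
  obtain ⟨rfl, rfl⟩ := Prod.ext_iff.1 (hmin.unique (hminh.lift hQ))
  have hw : x0 + Q *ᵥ xh + v - x0 = Q *ᵥ xh + v := by abel
  have hQw : Qᵀ *ᵥ (Q *ᵥ xh + v) = xh := by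
    rw [mulVec_add, hv.transpose_mulVec_eq_zero, mulVec_mulVec, hQ, one_mulVec, add_zero]
  have hdot (u : Fin d → ℝ) : Q *ᵥ u ⬝ᵥ (Q *ᵥ xh + v) = u ⬝ᵥ xh := by
    rw [dotProduct_add, hv u, add_zero, mulVec_dotProduct_mulVec_of_orthonormal hQ]
  rw [hw, hfh0]
  simp only [Matrix.mul_assoc, ← mulVec_mulVec, hQw, hdot,
    dotProduct_comm (Q *ᵥ xh + v) (Q *ᵥ _), dotProduct_comm xh]
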